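/- Let d ≥ 1, let ρ : ℝ^d → ℝ be continuously differentiable and everywhere strictly positive, let c : ℝ^d → ℝ^d be continuous, and let L be the operator Lf = ½Δf + ⟨c, ∇f⟩. Suppose that L is symmetric on smooth compactly supported functions in L²(ℝ^d, ρ dx), i.e. ∫ (Lf) g ρ dx = ∫ f (Lg) ρ dx for all f, g ∈ C_c^∞(ℝ^d). Then 2c(x) = ∇(log ρ)(x) for every x ∈ ℝ^d; in particular the drift c is a gradient field. -/

import Mathlib

open MeasureTheory

/-- The partial derivative in the `i`-th coordinate direction of a function
on `ℝ^d` (modelled as `EuclideanSpace ℝ (Fin d)`). -/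
noncomputable def pder {d : ℕ} (i : Fin d)
    (f : EuclideanSpace ℝ (Fin d) → ℝ) : EuclideanSpace ℝ (Fin d) → ℝ :=
  fun x => fderiv ℝ f x (EuclideanSpace.single i 1)

section FirstOrderForm

variable {E : Type*} [NormedAddCommGroup E] [NormedSpace ℝ E]

/-- Every linear form is the derivative at `x` of a smooth compactly supported function. -/
lemma exists_contDiff_hasCompactSupport_fderiv_eq [FiniteDimensional ℝ E]
    (φ : E →L[ℝ] ℝ) (x : E) :
    ∃ f : E → ℝ, ContDiff ℝ (⊤ : ℕ∞) f ∧ HasCompactSupport f ∧ fderiv ℝ f x = φ := by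
  let η : ContDiffBump x := default
  refine ⟨fun y => η y * φ y, η.contDiff.mul φ.contDiff, η.hasCompactSupport.mul_right, ?_⟩
  have h : (fun y => η y * φ y) =ᶠ[nhds x] φ := by
    filter_upwards [η.eventuallyEq_one] with y hy
    simp [hy]
  rw [h.fderiv_eq, φ.fderiv]

variable [MeasurableSpace E] [BorelSpace E]

/-- A directional derivative of a compactly supported `C¹` function has zero integral. -/
lemma integral_fderiv_apply_eq_zero [FiniteDimensional ℝ E]
    {μ : Measure E} [μ.IsAddHaarMeasure] {u : E → ℝ}
    (hu : ContDiff ℝ 1 u) (hsupp : HasCompactSupport u) (v : E) :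
    ∫ x, fderiv ℝ u x v ∂μ = 0 := by
  have hderiv : Integrable (fun x => fderiv ℝ u x v) μ :=
    ((hu.continuous_fderiv one_ne_zero).clm_apply continuous_const).integrable_of_hasCompactSupport
      (hsupp.fderiv_apply ℝ v)
  have h := integral_mul_fderiv_eq_neg_fderiv_mul_of_integrable (μ := μ)
    (f := fun _ : E => (1 : ℝ)) (g := u) (v := v) (by simp) (by simpa using hderiv)
    (by simpa using hu.continuous.integrable_of_hasCompactSupport hsupp)
    (fun _ _ => differentiableAt_const _)
    (fun x _ => hu.differentiable one_ne_zero x)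
  simpa using h

/-- If the form `(f, g) ↦ ∫ g ⟨b, ∇f⟩` of a continuous vector field `b` is symmetric on test
functions, then it vanishes whenever `g` is a product of two test functions. -/
lemma integral_mul_mul_fderiv_eq_zero {μ : Measure E} [IsFiniteMeasureOnCompacts μ]
    {b : E → E} (hb : Continuous b)
    (hsym : ∀ f g : E → ℝ, ContDiff ℝ (⊤ : ℕ∞) f → HasCompactSupport f →
      ContDiff ℝ (⊤ : ℕ∞) g → HasCompactSupport g →
      ∫ x, g x * fderiv ℝ f x (b x) ∂μ = ∫ x, f x * fderiv ℝ g x (b x) ∂μ)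
    {f g h : E → ℝ} (hf : ContDiff ℝ (⊤ : ℕ∞) f) (hf' : HasCompactSupport f)
    (hg : ContDiff ℝ (⊤ : ℕ∞) g) (hg' : HasCompactSupport g)
    (hh : ContDiff ℝ (⊤ : ℕ∞) h) (hh' : HasCompactSupport h) :
    ∫ x, h x * (g x * fderiv ℝ f x (b x)) ∂μ = 0 := by
  have leibniz : ∀ u v w : E → ℝ, ContDiff ℝ (⊤ : ℕ∞) u → HasCompactSupport u →
      ContDiff ℝ (⊤ : ℕ∞) v → HasCompactSupport v →
      ContDiff ℝ (⊤ : ℕ∞) w → HasCompactSupport w →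
      (∫ x, w x * (u x * fderiv ℝ v x (b x)) ∂μ) + ∫ x, w x * (v x * fderiv ℝ u x (b x)) ∂μ
        = ∫ x, u x * (v x * fderiv ℝ w x (b x)) ∂μ := by
    intro u v w hu hu' hv hv' hw hw'
    have key := hsym (fun x => u x * v x) w (hu.mul hv) hu'.mul_right hw hw'
    have integrable : ∀ p q : E → ℝ, ContDiff ℝ (⊤ : ℕ∞) p → ContDiff ℝ (⊤ : ℕ∞) q →
        Integrable (fun x => w x * (p x * fderiv ℝ q x (b x))) μ := by
      intro p q hp hq
      exact (hw.continuous.mul (hp.continuous.mul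
        ((hq.continuous_fderiv (by simp)).clm_apply hb))).integrable_of_hasCompactSupport
        hw'.mul_right
    rw [← integral_add (integrable u v hu hv) (integrable v u hv hu)]
    simp only [← mul_assoc] at key ⊢
    rw [← key]
    refine integral_congr_ae (.of_forall fun x => ?_)
    have hD : fderiv ℝ (fun x => u x * v x) x = u x • fderiv ℝ v x + v x • fderiv ℝ u x :=
      fderiv_fun_mul (hu.differentiable (by simp) x) (hv.differentiable (by simp) x)
    simp only [hD, add_apply, smul_apply, smul_eq_mul]
    ring
  have h₁ := leibniz g f h hg hg' hf hf' hh hh'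
  have h₂ := leibniz h f g hh hh' hf hf' hg hg'
  have swap : ∀ u v w : E → ℝ, ∫ x, u x * (v x * fderiv ℝ w x (b x)) ∂μ
      = ∫ x, v x * (u x * fderiv ℝ w x (b x)) ∂μ := fun u v w => by
    simp only [mul_left_comm]
  rw [swap g h f, swap g f h] at h₂
  rw [swap g f h] at h₁
  linarith

/-- A continuous vector field whose first-order form `(f, g) ↦ ∫ g ⟨b, ∇f⟩` is symmetric on test
functions is zero. -/
lemma eq_zero_of_integral_mul_fderiv_symmetric [FiniteDimensional ℝ E]
    {μ : Measure E} [μ.IsAddHaarMeasure] {b : E → E} (hb : Continuous b)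
    (hsym : ∀ f g : E → ℝ, ContDiff ℝ (⊤ : ℕ∞) f → HasCompactSupport f →
      ContDiff ℝ (⊤ : ℕ∞) g → HasCompactSupport g →
      ∫ x, g x * fderiv ℝ f x (b x) ∂μ = ∫ x, f x * fderiv ℝ g x (b x) ∂μ) (x : E) :
    b x = 0 := by
  refine SeparatingDual.eq_zero_of_forall_dual_eq_zero (R := ℝ) fun φ => ?_
  obtain ⟨f, hf, hf', hfx⟩ := exists_contDiff_hasCompactSupport_fderiv_eq φ x
  let η : ContDiffBump x := default
  have hcont : Continuous fun y => η y * fderiv ℝ f y (b y) :=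
    η.continuous.mul ((hf.continuous_fderiv (by simp)).clm_apply hb)
  have hae : ∀ᵐ y ∂μ, η y * fderiv ℝ f y (b y) = 0 :=
    ae_eq_zero_of_integral_contDiff_smul_eq_zero hcont.locallyIntegrable fun h hh hh' =>
      integral_mul_mul_fderiv_eq_zero hb hsym hf hf' η.contDiff η.hasCompactSupport hh hh'
  have hzero := congrFun ((hcont.ae_eq_iff_eq μ continuous_const).1 hae) x
  simpa [η.eventuallyEq_one.eq_of_nhds, hfx] using hzero

end FirstOrderForm

section Euclidean

variable {d : ℕ}

lemma sum_pder_mul_pder_eq_fderiv_gradient (f ρ : EuclideanSpace ℝ (Fin d) → ℝ)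
    (x : EuclideanSpace ℝ (Fin d)) :
    ∑ i, pder i ρ x * pder i f x = fderiv ℝ f x (gradient ρ x) := by
  conv_rhs => rw [← (EuclideanSpace.basisFun (Fin d) ℝ).sum_repr' (gradient ρ x)]
  simp [pder]

lemma contDiff_pder {f : EuclideanSpace ℝ (Fin d) → ℝ} (hf : ContDiff ℝ (⊤ : ℕ∞) f) (i : Fin d) :
    ContDiff ℝ (⊤ : ℕ∞) (pder i f) :=
  (hf.fderiv_right (m := (⊤ : ℕ∞)) (by simp)).clm_apply contDiff_const

lemma pder_mul {u v : EuclideanSpace ℝ (Fin d) → ℝ} {x : EuclideanSpace ℝ (Fin d)}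
    (hu : DifferentiableAt ℝ u x) (hv : DifferentiableAt ℝ v x) (i : Fin d) :
    pder i (fun y => u y * v y) x = u x * pder i v x + v x * pder i u x := by
  simp [pder, fderiv_fun_mul hu hv]

lemma pder_sub {u v : EuclideanSpace ℝ (Fin d) → ℝ} {x : EuclideanSpace ℝ (Fin d)}
    (hu : DifferentiableAt ℝ u x) (hv : DifferentiableAt ℝ v x) (i : Fin d) :
    pder i (fun y => u y - v y) x = pder i u x - pder i v x := by
  simp [pder, fderiv_fun_sub hu hv]

/-- The antisymmetric part of the second-order form is the divergence of `ρ (g ∇f - f ∇g)` up to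
first-order terms. -/
lemma sum_pder_antisymmetric_flux {f g ρ : EuclideanSpace ℝ (Fin d) → ℝ}
    (hf : ContDiff ℝ (⊤ : ℕ∞) f) (hg : ContDiff ℝ (⊤ : ℕ∞) g) (hρ : ContDiff ℝ 1 ρ)
    (x : EuclideanSpace ℝ (Fin d)) :
    ∑ i, pder i (fun y => ρ y * (g y * pder i f y - f y * pder i g y)) x
      = ρ x * (g x * ∑ i, pder i (pder i f) x - f x * ∑ i, pder i (pder i g) x)
        + (g x * fderiv ℝ f x (gradient ρ x) - f x * fderiv ℝ g x (gradient ρ x)) := by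
  have hfx : DifferentiableAt ℝ f x := hf.differentiable (by simp) x
  have hgx : DifferentiableAt ℝ g x := hg.differentiable (by simp) x
  simp only [← sum_pder_mul_pder_eq_fderiv_gradient, Finset.mul_sum, ← Finset.sum_sub_distrib,
    ← Finset.sum_add_distrib]
  refine Finset.sum_congr rfl fun i _ => ?_
  have hfi : DifferentiableAt ℝ (pder i f) x := (contDiff_pder hf i).differentiable (by simp) x
  have hgi : DifferentiableAt ℝ (pder i g) x := (contDiff_pder hg i).differentiable (by simp) x
  rw [pder_mul (hρ.differentiable one_ne_zero x) ((hgx.fun_mul hfi).fun_sub (hfx.fun_mul hgi)),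
    pder_sub (hgx.fun_mul hfi) (hfx.fun_mul hgi), pder_mul hgx hfi, pder_mul hfx hgi]
  ring

lemma continuous_gradient {ρ : EuclideanSpace ℝ (Fin d) → ℝ} (hρ : ContDiff ℝ 1 ρ) :
    Continuous (gradient ρ) :=
  (InnerProductSpace.toDual ℝ _).symm.continuous.comp (hρ.continuous_fderiv one_ne_zero)

lemma gradient_log {ρ : EuclideanSpace ℝ (Fin d) → ℝ} {x : EuclideanSpace ℝ (Fin d)}
    (hρ : DifferentiableAt ℝ ρ x) (hx : ρ x ≠ 0) :
    gradient (fun y => Real.log (ρ y)) x = (ρ x)⁻¹ • gradient ρ x := by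
  simp [gradient, fderiv.log hρ hx]

end Euclidean

/-- Converse direction: if `ρ > 0` is `C¹`, `c` is continuous, and the operator
`L f = ½Δf + ⟨c, ∇f⟩` is symmetric on `C_c^∞(ℝ^d)` in `L²(ℝ^d, ρ dx)`, then
`2c = ∇(log ρ)` everywhere; in particular the drift is a gradient field. -/
theorem symmetric_implies_gradient_drift {d : ℕ} (hd : 1 ≤ d)
    (ρ : EuclideanSpace ℝ (Fin d) → ℝ)
    (hρ : ContDiff ℝ 1 ρ) (hρpos : ∀ x, 0 < ρ x)
    (c : EuclideanSpace ℝ (Fin d) → EuclideanSpace ℝ (Fin d))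
    (hc : Continuous c)
    (L : (EuclideanSpace ℝ (Fin d) → ℝ) → EuclideanSpace ℝ (Fin d) → ℝ)
    (hL : ∀ f x, L f x
      = (1 / 2) * (∑ i, pder i (pder i f) x)
        + (inner ℝ (c x) (gradient f x) : ℝ))
    (hsym : ∀ f g : EuclideanSpace ℝ (Fin d) → ℝ,
      ContDiff ℝ (⊤ : ℕ∞) f → HasCompactSupport f →
      ContDiff ℝ (⊤ : ℕ∞) g → HasCompactSupport g →
      ∫ x, L f x * g x * ρ x = ∫ x, f x * L g x * ρ x) :
    ∀ x, (2 : ℝ) • c x = gradient (fun y => Real.log (ρ y)) x := by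
  intro x
  let b : EuclideanSpace ℝ (Fin d) → EuclideanSpace ℝ (Fin d) :=
    fun x => ρ x • c x - (1 / 2 : ℝ) • gradient ρ x
  have hb : Continuous b := by
    have hgrad := continuous_gradient hρ
    have hρc := hρ.continuous
    fun_prop
  have hflux : ∀ f g : EuclideanSpace ℝ (Fin d) → ℝ,
      ContDiff ℝ (⊤ : ℕ∞) f → HasCompactSupport f →
      ContDiff ℝ (⊤ : ℕ∞) g → HasCompactSupport g → ∀ i,
      ContDiff ℝ 1 (fun y => ρ y * (g y * pder i f y - f y * pder i g y)) ∧
      HasCompactSupport (fun y => ρ y * (g y * pder i f y - f y * pder i g y)) := by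
    intro f g hf hf' hg hg' i
    refine ⟨hρ.mul (((hg.mul (contDiff_pder hf i)).sub (hf.mul (contDiff_pder hg i))).of_le
      (by exact_mod_cast le_top)), ?_⟩
    exact (hg'.mul_right.sub hf'.mul_right).mul_left
  have hform : ∀ f g : EuclideanSpace ℝ (Fin d) → ℝ,
      ContDiff ℝ (⊤ : ℕ∞) f → HasCompactSupport f →
      ContDiff ℝ (⊤ : ℕ∞) g → HasCompactSupport g →
      ∫ x, g x * fderiv ℝ f x (b x) = ∫ x, f x * fderiv ℝ g x (b x) := by
    intro f g hf hf' hg hg'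
    have hLcont : ∀ u : EuclideanSpace ℝ (Fin d) → ℝ, ContDiff ℝ (⊤ : ℕ∞) u →
        Continuous (L u) := by
      intro u hu
      have hLu : L u = fun x => (1 / 2) * (∑ i, pder i (pder i u) x) + fderiv ℝ u x (c x) := by
        ext x
        simp [hL]
      rw [hLu]
      exact (continuous_const.mul (continuous_finsetSum _ fun i _ =>
        (contDiff_pder (contDiff_pder hu i) i).continuous)).add
        ((hu.continuous_fderiv (by simp)).clm_apply hc)
    have hIf : Integrable fun x => L f x * g x * ρ x :=
      (((hLcont f hf).mul hg.continuous).mul hρ.continuous).integrable_of_hasCompactSupport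
        hg'.mul_left.mul_right
    have hIg : Integrable fun x => f x * L g x * ρ x :=
      ((hf.continuous.mul (hLcont g hg)).mul hρ.continuous).integrable_of_hasCompactSupport
        hf'.mul_right.mul_right
    have hJf : Integrable fun x => g x * fderiv ℝ f x (b x) :=
      (hg.continuous.mul ((hf.continuous_fderiv (by simp)).clm_apply hb)
        ).integrable_of_hasCompactSupport hg'.mul_right
    have hJg : Integrable fun x => f x * fderiv ℝ g x (b x) :=
      (hf.continuous.mul ((hg.continuous_fderiv (by simp)).clm_apply hb)
        ).integrable_of_hasCompactSupport hf'.mul_right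
    have hdiv : ∫ x, ∑ i, pder i (fun y => ρ y * (g y * pder i f y - f y * pder i g y)) x = 0 := by
      rw [integral_finsetSum]
      · exact Finset.sum_eq_zero fun i _ =>
          integral_fderiv_apply_eq_zero (hflux f g hf hf' hg hg' i).1
            (hflux f g hf hf' hg hg' i).2 _
      · intro i _
        obtain ⟨h₁, h₂⟩ := hflux f g hf hf' hg hg' i
        exact ((h₁.continuous_fderiv one_ne_zero).clm_apply
          continuous_const).integrable_of_hasCompactSupport (h₂.fderiv_apply ℝ _)
    have hpoint : ∀ x, ∑ i, pder i (fun y => ρ y * (g y * pder i f y - f y * pder i g y)) x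
        = 2 * ((L f x * g x * ρ x - f x * L g x * ρ x)
          - (g x * fderiv ℝ f x (b x) - f x * fderiv ℝ g x (b x))) := by
      intro x
      rw [sum_pder_antisymmetric_flux hf hg hρ, hL f, hL g]
      simp only [b, map_sub, map_smul, smul_eq_mul, inner_gradient_right, conj_trivial]
      ring
    simp only [hpoint] at hdiv
    rw [integral_const_mul, integral_sub (hIf.sub' hIg) (hJf.sub' hJg), integral_sub hIf hIg,
      integral_sub hJf hJg, hsym f g hf hf' hg hg'] at hdiv
    linarith
  have hbx : ρ x • c x = (1 / 2 : ℝ) • gradient ρ x :=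
    sub_eq_zero.1 (eq_zero_of_integral_mul_fderiv_symmetric hb hform x)
  have hρx := (hρpos x).ne'
  rw [gradient_log (hρ.differentiable one_ne_zero x) hρx, eq_inv_smul_iff₀ hρx, smul_comm, hbx,
    smul_smul]
  norm_num
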